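/- The two-dimensional moment problem in the strip Π(R) — finding a non-negative Borel measure μ on Π(R) with ∫ x₁ᵐ x₂ⁿ dμ = s_{m,n} for all m,n ∈ ℤ₊ — has a solution if and only if for every finitely supported complex family (α_{m,n}): (i) ∑ α_{m,n} conj(α_{k,l}) s_{m+k,n+l} ≥ 0, and (ii) ∑ α_{m,n} conj(α_{k,l}) (R² s_{m+k,n+l} − s_{m+k,n+l+2}) ≥ 0. -/

import Mathlib

open MeasureTheory Finsupp
open scoped ComplexOrder

theorem Polynomial.isSumSq_of_forall_eval_nonneg (q : Polynomial ℝ)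
    (hq : ∀ x, 0 ≤ q.eval x) : IsSumSq q := by
  induction hn : q.natDegree using Nat.strong_induction_on generalizing q with
  | _ n ih =>
  have isSumSq_C : ∀ c : ℝ, 0 ≤ c → IsSumSq (Polynomial.C c) := fun c hc =>
    IsSquare.isSumSq ⟨Polynomial.C √c, by rw [← Polynomial.C_mul, Real.mul_self_sqrt hc]⟩
  rcases Nat.eq_zero_or_pos q.natDegree with h0 | hpos
  · rw [Polynomial.eq_C_of_natDegree_eq_zero h0] at hq ⊢
    exact isSumSq_C _ (by simpa using hq 0)
  obtain ⟨a, ha⟩ := q.exists_forall_norm_le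
  simp only [Real.norm_of_nonneg (hq _)] at ha
  have hroot : (q - Polynomial.C (q.eval a)).IsRoot a := by simp
  have hderiv : (Polynomial.derivative (q - Polynomial.C (q.eval a))).IsRoot a := by
    have hmin : IsLocalMin (fun x => q.eval x) a := Filter.Eventually.of_forall ha
    simpa using hmin.deriv_eq_zero
  have hne : q - Polynomial.C (q.eval a) ≠ 0 := fun h => by
    rw [sub_eq_zero] at h
    rw [h, Polynomial.natDegree_C] at hpos
    exact hpos.false
  obtain ⟨r, hr⟩ : (Polynomial.X - Polynomial.C a) ^ 2 ∣ q - Polynomial.C (q.eval a) :=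
    (Polynomial.le_rootMultiplicity_iff hne).1
      ((Polynomial.one_lt_rootMultiplicity_iff_isRoot hne).2 ⟨hroot, hderiv⟩)
  have hr0 : r ≠ 0 := by rintro rfl; simp [hne] at hr
  have hdeg : r.natDegree < n := by
    have h := congrArg Polynomial.natDegree hr
    rw [Polynomial.natDegree_sub_C, Polynomial.natDegree_mul
      (pow_ne_zero _ (Polynomial.X_sub_C_ne_zero a)) hr0] at h
    simp at h
    omega
  have hr_nonneg : ∀ x, 0 ≤ r.eval x := by
    have hdense : Dense ({a}ᶜ : Set ℝ) := dense_compl_singleton a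
    have hclosed : IsClosed {x | 0 ≤ r.eval x} := isClosed_le continuous_const r.continuous
    intro x
    refine hclosed.closure_subset_iff.2 (fun y hy => ?_) (hdense x)
    have h := congrArg (Polynomial.eval y) hr
    simp only [Polynomial.eval_sub, Polynomial.eval_C, Polynomial.eval_mul, Polynomial.eval_pow,
      Polynomial.eval_X] at h
    have hy' : 0 < (y - a) ^ 2 := by
      have : y - a ≠ 0 := sub_ne_zero.2 hy
      positivity
    exact nonneg_of_mul_nonneg_right (h ▸ sub_nonneg.2 (ha y)) hy'
  rw [← sub_add_cancel q (Polynomial.C (q.eval a)), hr]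
  exact ((IsSquare.isSumSq ⟨Polynomial.X - Polynomial.C a, sq _⟩).mul
    (ih _ hdeg r hr_nonneg rfl)).add (isSumSq_C _ (hq a))

theorem choose_div_choose_mem_Icc {N n i : ℕ} (hi : i ≤ N) :
    (i.choose n : ℝ) / N.choose n ∈ Set.Icc (0 : ℝ) 1 :=
  ⟨by positivity, div_le_one_of_le₀ (by exact_mod_cast Nat.choose_le_choose n hi) (by positivity)⟩

theorem choose_succ_div_choose_succ {N n i : ℕ} (h : n < N) :
    (i.choose (n + 1) : ℝ) / N.choose (n + 1) =
      (i.choose n : ℝ) / N.choose n * ((i - n : ℕ) / (N - n : ℕ)) := by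
  have h1 : ∀ k : ℕ, (k.choose (n + 1) : ℝ) * (n + 1) = k.choose n * (k - n : ℕ) := fun k => by
    exact_mod_cast Nat.choose_succ_right_eq k n
  have h2 : (N.choose n : ℝ) ≠ 0 := by exact_mod_cast (Nat.choose_pos h.le).ne'
  have h3 : (N.choose (n + 1) : ℝ) ≠ 0 := by exact_mod_cast (Nat.choose_pos h).ne'
  have h4 : ((N - n : ℕ) : ℝ) ≠ 0 := by exact_mod_cast (Nat.sub_pos_of_lt h).ne'
  have h5 : (n + 1 : ℝ) ≠ 0 := by positivity
  field_simp
  apply mul_right_cancel₀ h5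
  linear_combination (N.choose n * (N - n : ℕ) : ℝ) * h1 i - (i.choose n * (i - n : ℕ) : ℝ) * h1 N

theorem abs_choose_div_choose_sub_pow_le {N i : ℕ} (hi : i ≤ N) (n : ℕ) (h : n < N) :
    |(i.choose n : ℝ) / N.choose n - ((i : ℝ) / N) ^ n| ≤ n ^ 2 / (N - n) := by
  induction n with
  | zero => simp
  | succ n ih =>
    have hn : n < N := by omega
    have hN : (0 : ℝ) < N := by exact_mod_cast (by omega : 0 < N)
    have hNn : (0 : ℝ) < N - n - 1 := by
      have : ((n + 1 : ℕ) : ℝ) < N := by exact_mod_cast h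
      push_cast at this; linarith
    have hiN : (i : ℝ) ≤ N := by exact_mod_cast hi
    specialize ih hn
    rw [choose_succ_div_choose_succ hn, pow_succ]
    obtain ⟨hw0, hw1⟩ := choose_div_choose_mem_Icc (n := n) hi
    set w := (i.choose n : ℝ) / N.choose n
    have hv0 : (0 : ℝ) ≤ i / N := by positivity
    have hv1 : (i : ℝ) / N ≤ 1 := div_le_one_of_le₀ hiN hN.le
    have huv : |((i - n : ℕ) : ℝ) / (N - n : ℕ) - i / N| ≤ n / (N - n) := by
      rw [Nat.cast_sub hn.le]
      have hpos : (0 : ℝ) < N - n := by linarith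
      rcases le_total n i with hni | hni
      · rw [Nat.cast_sub hni, abs_le]
        constructor
        · rw [neg_le_sub_iff_le_add, div_add_div _ _ hpos.ne' hpos.ne',
            div_le_div_iff₀ hN (by positivity)]
          nlinarith [mul_nonneg (Nat.cast_nonneg (α := ℝ) n) (Nat.cast_nonneg (α := ℝ) i),
            mul_nonneg (mul_nonneg (Nat.cast_nonneg (α := ℝ) n) (Nat.cast_nonneg (α := ℝ) i)) hpos.le]
        · rw [sub_le_iff_le_add]
          have : ((i : ℝ) - n) / (N - n) ≤ i / N := by
            rw [div_le_div_iff₀ hpos hN]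
            nlinarith [mul_nonneg (Nat.cast_nonneg (α := ℝ) n) (sub_nonneg.2 hiN)]
          have : (0 : ℝ) ≤ n / (N - n) := by positivity
          linarith
      · rw [Nat.sub_eq_zero_of_le hni]
        simp only [Nat.cast_zero, zero_div, zero_sub, abs_neg, abs_of_nonneg hv0]
        have : (i : ℝ) ≤ n := by exact_mod_cast hni
        gcongr
        linarith [(Nat.cast_nonneg (α := ℝ) n)]
    set u := ((i - n : ℕ) : ℝ) / (N - n : ℕ)
    set v := (i : ℝ) / N
    calc |w * u - v ^ n * v| = |w * (u - v) + (w - v ^ n) * v| := by ring_nf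
      _ ≤ |w * (u - v)| + |(w - v ^ n) * v| := abs_add_le _ _
      _ = w * |u - v| + |w - v ^ n| * v := by rw [abs_mul, abs_mul, abs_of_nonneg hw0, abs_of_nonneg hv0]
      _ ≤ 1 * |u - v| + |w - v ^ n| * 1 := by gcongr
      _ ≤ n / (N - n) + n ^ 2 / (N - n) := by linarith
      _ = (n + n ^ 2) / (N - n) := by ring
      _ ≤ ((n + 1 : ℕ) : ℝ) ^ 2 / (N - (n + 1 : ℕ)) := by
        push_cast
        apply div_le_div₀ (by positivity) (by nlinarith [(Nat.cast_nonneg (α := ℝ) n)]) (by linarith) (by linarith)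

theorem sum_choose_mul_bernstein {A : Type*} [CommRing A] (T : A) {n N : ℕ} (h : n ≤ N) :
    ∑ i ∈ Finset.range (N + 1), (i.choose n : A) * (N.choose i * T ^ i * (1 - T) ^ (N - i)) =
      N.choose n * T ^ n := by
  obtain ⟨M, rfl⟩ := Nat.exists_eq_add_of_le h
  rw [show n + M + 1 = n + (M + 1) by ring, Finset.sum_range_add, Finset.sum_eq_zero, zero_add]
  · have hb := add_pow T (1 - T) M
    rw [add_sub_cancel, one_pow] at hb
    refine Eq.trans ?_ ((congrArg (((n + M).choose n : A) * T ^ n * ·) hb.symm).trans (mul_one _))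
    simp only [Finset.mul_sum]
    refine Finset.sum_congr rfl fun k hk => ?_
    have hk' : k ≤ M := by simpa [Nat.lt_succ_iff] using hk
    have hc := Nat.choose_mul (n := n + M) (k := n + k) (s := n) (by omega)
    rw [show n + M - n = M by omega, show n + k - n = k by omega] at hc
    have hc' : ((n + M).choose (n + k) : A) * (n + k).choose n = (n + M).choose n * M.choose k := by
      exact_mod_cast congrArg (Nat.cast (R := A)) hc
    rw [show n + M - (n + k) = M - k by omega, pow_add]
    linear_combination (T ^ n * T ^ k * (1 - T) ^ (M - k)) * hc'
  · intro i hi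
    rw [Nat.choose_eq_zero_of_lt (Finset.mem_range.1 hi)]
    simp

theorem IsSumSq.map_ringHom {S T : Type*} [CommRing S] [CommRing T] {a : S} (h : IsSumSq a)
    (f : S →+* T) : IsSumSq (f a) := by
  induction h with
  | zero => simp
  | sq_add a _ ih =>
    rw [map_add, map_mul]
    exact (IsSumSq.mul_self _).add ih

/-- `w` has nonnegative `L`-value against every square. -/
def IsSquarePositive {A : Type*} [CommRing A] [Algebra ℝ A] (L : A →ₗ[ℝ] ℝ) (w : A) : Prop :=
  ∀ a, 0 ≤ L (a ^ 2 * w)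

namespace IsSquarePositive

variable {A : Type*} [CommRing A] [Algebra ℝ A] {L : A →ₗ[ℝ] ℝ} {v w : A}

theorem nonneg (h : IsSquarePositive L w) : 0 ≤ L w := by simpa using h 1

theorem add (hv : IsSquarePositive L v) (hw : IsSquarePositive L w) :
    IsSquarePositive L (v + w) := fun a => by
  rw [mul_add, map_add]; exact add_nonneg (hv a) (hw a)

theorem sq_mul (hw : IsSquarePositive L w) (b : A) : IsSquarePositive L (b ^ 2 * w) := fun a => by
  rw [← mul_assoc, ← mul_pow]; exact hw _

theorem natCast_mul (hw : IsSquarePositive L w) (n : ℕ) : IsSquarePositive L (n * w) := fun a => by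
  rw [mul_left_comm, ← nsmul_eq_mul, map_nsmul]; exact nsmul_nonneg (hw a) n

theorem mul_isSumSq (hw : IsSquarePositive L w) (hv : IsSumSq v) : IsSquarePositive L (w * v) := by
  induction hv with
  | zero => intro a; simp
  | sq_add a _ ih =>
    rw [mul_add, ← sq, mul_comm w]
    exact (hw.sq_mul a).add ih

theorem pow_mul_one_sub_pow {T : A} (h1 : IsSquarePositive L 1)
    (h2 : IsSquarePositive L (T * (1 - T))) (i j : ℕ) :
    IsSquarePositive L (T ^ i * (1 - T) ^ j) := by
  obtain ⟨k, rfl | rfl⟩ := Nat.even_or_odd' i <;> obtain ⟨l, rfl | rfl⟩ := Nat.even_or_odd' j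
  · convert h1.sq_mul (T ^ k * (1 - T) ^ l) using 1; ring
  · convert ((h1.sq_mul (1 - T)).add h2).sq_mul (T ^ k * (1 - T) ^ l) using 1; ring
  · convert ((h1.sq_mul T).add h2).sq_mul (T ^ k * (1 - T) ^ l) using 1; ring
  · convert h2.sq_mul (T ^ k * (1 - T) ^ l) using 1; ring

theorem abs_map_mul_pow_le (hw : IsSquarePositive L w) (X : A) (m : ℕ) :
    |L (w * X ^ m)| ≤ L (w * (1 + X ^ (2 * m))) := by
  have hm := hw (1 - X ^ m)
  have hp := hw (1 + X ^ m)
  have hX := hw (X ^ m)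
  have h0 := hw.nonneg
  have em : (1 - X ^ m) ^ 2 * w = w + (X ^ m) ^ 2 * w - (2 : ℝ) • (w * X ^ m) := by
    rw [Algebra.smul_def, map_ofNat]; ring
  have ep : (1 + X ^ m) ^ 2 * w = w + (X ^ m) ^ 2 * w + (2 : ℝ) • (w * X ^ m) := by
    rw [Algebra.smul_def, map_ofNat]; ring
  have e : w * (1 + X ^ (2 * m)) = w + (X ^ m) ^ 2 * w := by ring
  rw [em, map_sub, map_add, map_smul, smul_eq_mul] at hm
  rw [ep, map_add, map_add, map_smul, smul_eq_mul] at hp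
  rw [e, map_add, abs_le]
  constructor <;> linarith

end IsSquarePositive

/-- A linear functional that is nonnegative on `a ^ 2` and `a ^ 2 * (T * (1 - T))` is nonnegative
on every polynomial in `X`, `T` that is nonnegative on `ℝ × [0, 1]`. -/
theorem map_nonneg_of_nonneg_on_unit_strip {A : Type*} [CommRing A] [Algebra ℝ A]
    {L : A →ₗ[ℝ] ℝ} {X T : A} (h1 : IsSquarePositive L 1) (h2 : IsSquarePositive L (T * (1 - T)))
    {ι : Type*} (S : Finset ι) (c : ι → ℝ) (m n : ι → ℕ)
    (hc : ∀ x : ℝ, ∀ t ∈ Set.Icc (0 : ℝ) 1, 0 ≤ ∑ d ∈ S, c d * (x ^ m d * t ^ n d)) :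
    0 ≤ L (∑ d ∈ S, c d • (X ^ m d * T ^ n d)) := by
  set D : ℝ := ∑ d ∈ S, |c d| * L (1 + X ^ (2 * m d)) with hD
  have key : ∀ K N : ℕ, (∀ d ∈ S, n d ≤ K) → K < N →
      -(K ^ 2 / ((N : ℝ) - K) * D) ≤ L (∑ d ∈ S, c d • (X ^ m d * T ^ n d)) := by
    intro K N hK hKN
    have hKN' : (0 : ℝ) < N - K := sub_pos.2 (by exact_mod_cast hKN)
    set b : ℕ → A := fun i => N.choose i * T ^ i * (1 - T) ^ (N - i) with hb
    have hb_pos : ∀ i, IsSquarePositive L (b i) := fun i => by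
      simpa only [hb, mul_assoc] using (h1.pow_mul_one_sub_pow h2 i (N - i)).natCast_mul (N.choose i)
    have hT : ∀ d ∈ S, T ^ n d =
        ∑ i ∈ Finset.range (N + 1), ((i.choose (n d) : ℝ) / N.choose (n d)) • b i := by
      intro d hd
      have hne : (N.choose (n d) : ℝ) ≠ 0 := by
        exact_mod_cast (Nat.choose_pos ((hK d hd).trans hKN.le)).ne'
      have h := sum_choose_mul_bernstein T ((hK d hd).trans hKN.le)
      calc T ^ n d = (N.choose (n d) : ℝ)⁻¹ • ((N.choose (n d) : A) * T ^ n d) := by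
            rw [← nsmul_eq_mul, ← Nat.cast_smul_eq_nsmul ℝ, inv_smul_smul₀ hne]
        _ = _ := by
            rw [← h, Finset.smul_sum]
            refine Finset.sum_congr rfl fun i _ => ?_
            rw [← nsmul_eq_mul, ← Nat.cast_smul_eq_nsmul ℝ, smul_smul, div_eq_inv_mul]
    have hsum_b : ∑ i ∈ Finset.range (N + 1), b i = 1 := by
      simpa using sum_choose_mul_bernstein T (Nat.zero_le N)
    have hmain : ∀ i ∈ Finset.range (N + 1),
        0 ≤ L (∑ d ∈ S, (c d * ((i : ℝ) / N) ^ n d) • (b i * X ^ m d)) := by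
      intro i hi
      have hi' : (i : ℝ) ≤ N := by exact_mod_cast Nat.lt_succ_iff.1 (Finset.mem_range.1 hi)
      set q : Polynomial ℝ :=
        ∑ d ∈ S, Polynomial.C (c d * ((i : ℝ) / N) ^ n d) * Polynomial.X ^ m d with hq
      have hq_nonneg : ∀ x, 0 ≤ q.eval x := fun x => by
        convert hc x (i / N) ⟨by positivity, div_le_one_of_le₀ hi' (by positivity)⟩ using 1
        simp only [hq, Polynomial.eval_finsetSum, Polynomial.eval_mul, Polynomial.eval_C,
          Polynomial.eval_pow, Polynomial.eval_X]
        exact Finset.sum_congr rfl fun d _ => by ring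
      have hsq : IsSumSq (Polynomial.aeval X q) :=
        (Polynomial.isSumSq_of_forall_eval_nonneg q hq_nonneg).map_ringHom
          (Polynomial.aeval X : Polynomial ℝ →ₐ[ℝ] A).toRingHom
      convert ((hb_pos i).mul_isSumSq hsq).nonneg using 2
      simp only [hq, map_sum, map_mul, map_pow, Polynomial.aeval_X, Polynomial.aeval_C,
        Finset.mul_sum, Algebra.smul_def]
      exact Finset.sum_congr rfl fun d _ => by ring
    have hsplit : L (∑ d ∈ S, c d • (X ^ m d * T ^ n d)) =
        ∑ i ∈ Finset.range (N + 1), L (∑ d ∈ S, (c d * ((i : ℝ) / N) ^ n d) • (b i * X ^ m d)) +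
        ∑ d ∈ S, ∑ i ∈ Finset.range (N + 1),
          c d * ((i.choose (n d) : ℝ) / N.choose (n d) - ((i : ℝ) / N) ^ n d) *
            L (b i * X ^ m d) := by
      simp only [map_sum, map_smul, smul_eq_mul]
      rw [Finset.sum_comm (s := Finset.range (N + 1)), ← Finset.sum_add_distrib]
      refine Finset.sum_congr rfl fun d hd => ?_
      rw [hT d hd, ← Finset.sum_add_distrib, Finset.mul_sum, map_sum, Finset.mul_sum]
      refine Finset.sum_congr rfl fun i _ => ?_
      rw [mul_smul_comm, map_smul, smul_eq_mul, mul_comm (X ^ _)]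
      ring
    have herr : |∑ d ∈ S, ∑ i ∈ Finset.range (N + 1),
          c d * ((i.choose (n d) : ℝ) / N.choose (n d) - ((i : ℝ) / N) ^ n d) *
            L (b i * X ^ m d)| ≤ K ^ 2 / ((N : ℝ) - K) * D := by
      rw [hD, Finset.mul_sum]
      refine (Finset.abs_sum_le_sum_abs _ _).trans (Finset.sum_le_sum fun d hd => ?_)
      have e : K ^ 2 / ((N : ℝ) - K) * (|c d| * L (1 + X ^ (2 * m d))) =
          ∑ i ∈ Finset.range (N + 1),
            |c d| * (K ^ 2 / ((N : ℝ) - K)) * L (b i * (1 + X ^ (2 * m d))) := by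
        rw [← Finset.mul_sum, ← map_sum, ← Finset.sum_mul, hsum_b, one_mul]; ring
      rw [e]
      refine (Finset.abs_sum_le_sum_abs _ _).trans (Finset.sum_le_sum fun i hi => ?_)
      rw [abs_mul, abs_mul]
      have hnK : (n d : ℝ) ≤ K := by exact_mod_cast hK d hd
      have hbound : |(i.choose (n d) : ℝ) / N.choose (n d) - ((i : ℝ) / N) ^ n d| ≤
          K ^ 2 / ((N : ℝ) - K) :=
        (abs_choose_div_choose_sub_pow_le (Nat.lt_succ_iff.1 (Finset.mem_range.1 hi)) _
          ((hK d hd).trans_lt hKN)).trans (by gcongr)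
      gcongr
      exact (hb_pos i).abs_map_mul_pow_le X (m d)
    rw [hsplit]
    have := Finset.sum_nonneg hmain
    have := (abs_le.1 herr).1
    linarith
  set K := S.sup n
  have hlim : Filter.Tendsto (fun N : ℕ => -(K ^ 2 / ((N : ℝ) - K) * D)) Filter.atTop
      (nhds (-(0 * D))) := by
    refine Filter.Tendsto.neg (Filter.Tendsto.mul_const _ ?_)
    exact Filter.Tendsto.const_div_atTop
      (Filter.tendsto_atTop_add_const_right _ _ tendsto_natCast_atTop_atTop) _
  rw [zero_mul, neg_zero] at hlim
  refine le_of_tendsto hlim ?_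
  filter_upwards [Filter.eventually_gt_atTop K] with N hN
  exact key K N (fun d hd => Finset.le_sup hd) hN

/-- A linear functional on polynomials in two variables that is nonnegative on `p ^ 2` and
`p ^ 2 * (R ^ 2 - y ^ 2)` is nonnegative on every polynomial that is nonnegative on the strip
`|y| ≤ R`. -/
theorem map_nonneg_of_nonneg_on_strip {R : ℝ} (hR : 0 < R) {L : MvPolynomial (Fin 2) ℝ →ₗ[ℝ] ℝ}
    (h1 : ∀ p, 0 ≤ L (p ^ 2))
    (h2 : ∀ p, 0 ≤ L (p ^ 2 * (MvPolynomial.C (R ^ 2) - MvPolynomial.X 1 ^ 2)))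
    (p : MvPolynomial (Fin 2) ℝ)
    (hp : ∀ x y : ℝ, |y| ≤ R → 0 ≤ MvPolynomial.eval ![x, y] p) : 0 ≤ L p := by
  set T : MvPolynomial (Fin 2) ℝ :=
    MvPolynomial.C (2 * R)⁻¹ * (MvPolynomial.X 1 + MvPolynomial.C R) with hT
  set Y : MvPolynomial (Fin 2) ℝ :=
    MvPolynomial.C R * (2 * MvPolynomial.X 1 - 1) with hY
  set q := MvPolynomial.aeval ![MvPolynomial.X 0, Y] p with hq
  have hC : (MvPolynomial.C (2 * R)⁻¹ * MvPolynomial.C (2 * R) : MvPolynomial (Fin 2) ℝ) = 1 := by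
    rw [← MvPolynomial.C_mul, inv_mul_cancel₀ (by positivity), MvPolynomial.C_1]
  have hC2 : (MvPolynomial.C (2 * R) : MvPolynomial (Fin 2) ℝ) = 2 * MvPolynomial.C R := by
    rw [MvPolynomial.C_mul, map_ofNat]
  have hp_eq : p = MvPolynomial.aeval ![MvPolynomial.X 0, T] q := by
    have hcomp : (MvPolynomial.aeval ![MvPolynomial.X 0, T]).comp
        (MvPolynomial.aeval ![MvPolynomial.X 0, Y]) = AlgHom.id ℝ (MvPolynomial (Fin 2) ℝ) := by
      refine MvPolynomial.algHom_ext fun i => ?_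
      fin_cases i
      · simp
      · have hYT : MvPolynomial.aeval ![MvPolynomial.X 0, T] Y =
            MvPolynomial.C R * (2 * T - 1) := by
          rw [hY, map_mul, map_sub, map_mul, map_one, map_ofNat, MvPolynomial.aeval_X,
            MvPolynomial.aeval_C]
          rfl
        simp only [AlgHom.comp_apply, MvPolynomial.aeval_X, Fin.mk_one, Matrix.cons_val_one,
          Matrix.cons_val_fin_one, AlgHom.id_apply]
        rw [hYT, hT]
        rw [hC2] at hC
        linear_combination (MvPolynomial.X 1 + MvPolynomial.C R) * hC
    exact (DFunLike.congr_fun hcomp p).symm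
  have hq_eval : ∀ x t : ℝ,
      MvPolynomial.eval ![x, t] q = MvPolynomial.eval ![x, R * (2 * t - 1)] p := by
    intro x t
    have hcomp : (MvPolynomial.aeval ![x, t]).comp
        (MvPolynomial.aeval ![MvPolynomial.X 0, Y]) =
        (MvPolynomial.aeval ![x, R * (2 * t - 1)] : MvPolynomial (Fin 2) ℝ →ₐ[ℝ] ℝ) := by
      refine MvPolynomial.algHom_ext fun i => ?_
      fin_cases i
      · simp
      · simp [hY]
    exact DFunLike.congr_fun hcomp p
  have hL1 : IsSquarePositive L 1 := fun a => by simpa using h1 a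
  have hLT : IsSquarePositive L (T * (1 - T)) := fun a => by
    have e : a ^ 2 * (T * (1 - T)) =
        (MvPolynomial.C (2 * R)⁻¹ * a) ^ 2 * (MvPolynomial.C (R ^ 2) - MvPolynomial.X 1 ^ 2) := by
      rw [hC2] at hC
      rw [hT, MvPolynomial.C_pow]
      linear_combination (-MvPolynomial.C (2 * R)⁻¹ * (MvPolynomial.X 1 + MvPolynomial.C R) * a ^ 2)
        * hC
    rw [e]
    exact h2 _
  rw [hp_eq, MvPolynomial.aeval_def, MvPolynomial.eval₂_eq']
  simp only [Fin.prod_univ_two, Matrix.cons_val_zero, Matrix.cons_val_one, Matrix.cons_val_fin_one,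
    ← Algebra.smul_def]
  refine map_nonneg_of_nonneg_on_unit_strip hL1 hLT _ _ _ _ fun x t ht => ?_
  have h := hp x (R * (2 * t - 1)) (by
    rw [abs_le]; constructor <;> nlinarith [ht.1, ht.2])
  rw [← hq_eval, MvPolynomial.eval_eq'] at h
  simpa [Fin.prod_univ_two] using h

open scoped CompactlySupported in
/-- A form of Haviland's theorem: a linear functional on an algebra of continuous functions that is
nonnegative on nonnegative functions is given by integration, as soon as the algebra has a
nonnegative element with compact sublevel sets. -/
theorem exists_measure_of_map_nonneg {K A : Type*} [TopologicalSpace K] [LocallyCompactSpace K]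
    [T2Space K] [MeasurableSpace K] [BorelSpace K] [CommRing A] [Algebra ℝ A]
    (ev : A →ₐ[ℝ] C(K, ℝ)) (L : A →ₗ[ℝ] ℝ) (hL : ∀ p, (∀ k, 0 ≤ ev p k) → 0 ≤ L p)
    (h : A) (h_nonneg : ∀ k, 0 ≤ ev h k) (h_compact : ∀ c : ℝ, IsCompact {k | ev h k ≤ c}) :
    ∃ μ : Measure K, ∀ p, Integrable (ev p) μ ∧ ∫ k, ev p k ∂μ = L p := by
  let cone : PointedCone ℝ (A × C_c(K, ℝ)) :=
    { carrier := {z | ∀ k, 0 ≤ ev z.1 k + z.2 k}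
      add_mem' := fun {a b} ha hb k => by
        have := add_nonneg (ha k) (hb k)
        simp only [Prod.fst_add, Prod.snd_add, map_add, ContinuousMap.add_apply,
          CompactlySupportedContinuousMap.add_apply]
        linarith
      zero_mem' := fun k => by simp
      smul_mem' := fun c z hz k => by
        have := mul_nonneg c.2 (hz k)
        change 0 ≤ ev ((c : ℝ) • z.1) k + ((c : ℝ) • z.2) k
        rw [map_smul, ContinuousMap.smul_apply, CompactlySupportedContinuousMap.smul_apply,
          smul_eq_mul, smul_eq_mul]
        linarith }
  let F : (A × C_c(K, ℝ)) →ₗ.[ℝ] ℝ :=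
    { domain := LinearMap.ker (LinearMap.snd ℝ A C_c(K, ℝ))
      toFun := (L.comp (LinearMap.fst ℝ A C_c(K, ℝ))).comp (Submodule.subtype _) }
  obtain ⟨g, hgF, hg⟩ := riesz_extension cone F
    (fun ⟨⟨p, f⟩, hf⟩ hpf => by
      obtain rfl : f = 0 := hf
      exact hL p fun k => by simpa using hpf k)
    (fun ⟨p, f⟩ => by
      obtain ⟨C, hC⟩ : ∃ C, ∀ k, ‖f k‖ ≤ C :=
        f.hasCompactSupport.exists_bound_of_continuous f.continuous
      refine ⟨⟨(algebraMap ℝ A C - p, 0), rfl⟩, fun k => ?_⟩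
      have := (abs_le.1 (hC k)).1
      simp only [Prod.mk_add_mk, sub_add_cancel, zero_add, AlgHomClass.commutes,
        _root_.algebraMap_apply, smul_eq_mul, mul_one]
      linarith)
  have hgL : ∀ p, g (p, 0) = L p := fun p => hgF ⟨(p, 0), rfl⟩
  let Λ : C_c(K, ℝ) →ₚ[ℝ] ℝ := PositiveLinearMap.mk₀ (g.comp (LinearMap.inr ℝ A C_c(K, ℝ)))
    fun f hf => hg _ fun k => by
      simpa using hf k
  have hΛ : ∀ f, Λ f = g (0, f) := fun f => rfl
  have hle : ∀ (p : A) (f : C_c(K, ℝ)), (∀ k, f k ≤ ev p k) → Λ f ≤ L p := fun p f hpf => by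
    have := hg (p, -f) fun k => by
      simpa using hpf k
    have e : ((p, -f) : A × C_c(K, ℝ)) = (p, 0) - (0, f) := by simp
    rw [e, map_sub, hgL, ← hΛ] at this
    linarith
  have hge : ∀ (p : A) (f : C_c(K, ℝ)), (∀ k, ev p k ≤ f k) → L p ≤ Λ f := fun p f hpf => by
    have := hle (-p) (-f) fun k => by simpa using hpf k
    rw [map_neg, map_neg] at this
    linarith
  set μ := RealRMK.rieszMeasure Λ
  have hnonneg : ∀ p, (∀ k, 0 ≤ ev p k) →
      Integrable (ev p) μ ∧ ∫ k, ev p k ∂μ = L p := by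
    intro p hp
    have hχ_cont : ∀ N : ℕ, Continuous fun k => max 0 (1 - ev h k / (N + 1)) := fun N => by fun_prop
    let f : ℕ → C_c(K, ℝ) := fun N =>
      { toFun := fun k => max 0 (1 - ev h k / (N + 1)) * ev p k
        continuous_toFun := (hχ_cont N).mul (ev p).continuous
        hasCompactSupport' := by
          refine HasCompactSupport.mul_right
            (HasCompactSupport.of_support_subset_isCompact (h_compact (N + 1)) fun k hk => ?_)
          rw [Function.mem_support] at hk
          by_contra hlt
          refine hk (max_eq_left ?_)
          have : 1 ≤ ev h k / (N + 1) := by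
            rw [one_le_div (by positivity)]
            exact (not_le.1 hlt).le
          linarith }
    have hf : ∀ N k, f N k = max 0 (1 - ev h k / (N + 1)) * ev p k := fun _ _ => rfl
    have hf_nonneg : ∀ N k, 0 ≤ f N k := fun N k => mul_nonneg (le_max_left _ _) (hp k)
    have hf_le : ∀ N k, f N k ≤ ev p k := fun N k => by
      rw [hf]
      refine mul_le_of_le_one_left (hp k) (max_le zero_le_one ?_)
      have : 0 ≤ ev h k / (N + 1) := div_nonneg (h_nonneg k) (by positivity)
      linarith
    have hf_ge : ∀ (N : ℕ) k, ev (p - ((N : ℝ) + 1)⁻¹ • (h * p)) k ≤ f N k := fun N k => by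
      rw [hf, map_sub, map_smul, map_mul]
      simp only [ContinuousMap.sub_apply, ContinuousMap.smul_apply, ContinuousMap.mul_apply,
        smul_eq_mul]
      have := mul_le_mul_of_nonneg_right (le_max_right 0 (1 - ev h k / (N + 1))) (hp k)
      refine le_trans (le_of_eq ?_) this
      ring
    have hlimL : Filter.Tendsto (fun N => Λ (f N)) Filter.atTop (nhds (L p)) := by
      have hlow : Filter.Tendsto (fun N : ℕ => L p - ((N : ℝ) + 1)⁻¹ * L (h * p)) Filter.atTop
          (nhds (L p)) := by
        have := (tendsto_one_div_add_atTop_nhds_zero_nat (𝕜 := ℝ)).mul_const (L (h * p))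
        simpa using this.const_sub (L p)
      refine tendsto_of_tendsto_of_tendsto_of_le_of_le hlow tendsto_const_nhds (fun N => ?_)
        fun N => hle p _ (hf_le N)
      have := hge _ _ (hf_ge N)
      rwa [map_sub, map_smul, smul_eq_mul] at this
    have hlim : Filter.Tendsto (fun N => ∫⁻ k, ENNReal.ofReal (f N k) ∂μ) Filter.atTop
        (nhds (∫⁻ k, ENNReal.ofReal (ev p k) ∂μ)) := by
      refine lintegral_tendsto_of_tendsto_of_monotone
        (fun N => (f N).continuous.measurable.ennreal_ofReal.aemeasurable)
        (ae_of_all _ fun k N M hNM => ENNReal.ofReal_le_ofReal ?_) (ae_of_all _ fun k => ?_)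
      · rw [hf, hf]
        have := h_nonneg k
        have := hp k
        gcongr
      · refine (ENNReal.continuous_ofReal.tendsto _).comp ?_
        have h0 : Filter.Tendsto (fun N : ℕ => 1 - ev h k / ((N : ℝ) + 1)) Filter.atTop
            (nhds 1) := by
          have := (tendsto_one_div_add_atTop_nhds_zero_nat (𝕜 := ℝ)).const_mul (ev h k)
          simpa [div_eq_mul_inv] using this.const_sub 1
        simpa [hf] using ((tendsto_const_nhds (x := (0 : ℝ))).max h0).mul_const (ev p k)
    have h_int : ∀ N, ∫⁻ k, ENNReal.ofReal (f N k) ∂μ = ENNReal.ofReal (Λ (f N)) := fun N => by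
      rw [← RealRMK.integral_rieszMeasure Λ (f N)]
      exact (ofReal_integral_eq_lintegral_ofReal (f N).integrable
        (ae_of_all _ (hf_nonneg N))).symm
    simp only [h_int] at hlim
    have hlint : ∫⁻ k, ENNReal.ofReal (ev p k) ∂μ = ENNReal.ofReal (L p) :=
      tendsto_nhds_unique hlim ((ENNReal.continuous_ofReal.tendsto _).comp hlimL)
    have hmeas : AEStronglyMeasurable (ev p) μ :=
      (ev p).continuous.measurable.aestronglyMeasurable
    refine ⟨⟨hmeas, ?_⟩, ?_⟩
    · rw [hasFiniteIntegral_iff_ofReal (ae_of_all _ hp), hlint]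
      exact ENNReal.ofReal_lt_top
    · rw [integral_eq_lintegral_of_nonneg_ae (ae_of_all _ hp) hmeas, hlint,
        ENNReal.toReal_ofReal (hL p hp)]
  refine ⟨μ, fun p => ?_⟩
  have hsq : ∀ q : A, ∀ k, 0 ≤ ev (q ^ 2) k := fun q k => by
    rw [map_pow, ContinuousMap.pow_apply]; positivity
  obtain ⟨i1, e1⟩ := hnonneg _ (hsq (p + 1))
  obtain ⟨i2, e2⟩ := hnonneg _ (hsq (p - 1))
  have hp : p = (4⁻¹ : ℝ) • ((p + 1) ^ 2 - (p - 1) ^ 2) := by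
    rw [show (p + 1) ^ 2 - (p - 1) ^ 2 = (4 : ℝ) • p by
      rw [Algebra.smul_def, map_ofNat]; ring, smul_smul]
    norm_num
  have hev : ⇑(ev p) = fun k => 4⁻¹ * (ev ((p + 1) ^ 2) k - ev ((p - 1) ^ 2) k) := by
    conv_lhs => rw [hp]
    rw [map_smul, map_sub]
    rfl
  rw [hev]
  refine ⟨(i1.sub i2).const_mul _, ?_⟩
  rw [integral_const_mul, integral_sub i1 i2, e1, e2]
  conv_rhs => rw [hp]
  rw [map_smul, map_sub, smul_eq_mul]

theorem sum_sum_mul_conj_nonneg_of_integral {μ : Measure (ℝ × ℝ)} {w : ℝ × ℝ → ℝ}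
    (hw : ∀ᵐ z ∂μ, 0 ≤ w z) {t : ℕ → ℕ → ℂ}
    (h_int : ∀ m n : ℕ, Integrable (fun z : ℝ × ℝ => w z * (z.1 ^ m * z.2 ^ n)) μ)
    (ht : ∀ m n : ℕ, ((∫ z : ℝ × ℝ, w z * (z.1 ^ m * z.2 ^ n) ∂μ : ℝ) : ℂ) = t m n)
    (S : Finset (ℕ × ℕ)) (a : ℕ × ℕ → ℂ) :
    0 ≤ ∑ p ∈ S, ∑ q ∈ S, a p * (starRingEnd ℂ) (a q) * t (p.1 + q.1) (p.2 + q.2) := by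
  have h_int' : ∀ p q : ℕ × ℕ, Integrable (fun z : ℝ × ℝ => a p * (starRingEnd ℂ) (a q) *
      ((w z * (z.1 ^ (p.1 + q.1) * z.2 ^ (p.2 + q.2)) : ℝ) : ℂ)) μ :=
    fun p q => (h_int _ _).ofReal.const_mul _
  have e : ∑ p ∈ S, ∑ q ∈ S, a p * (starRingEnd ℂ) (a q) * t (p.1 + q.1) (p.2 + q.2) =
      ∫ z : ℝ × ℝ,
        ((w z * Complex.normSq (∑ p ∈ S, a p * ((z.1 ^ p.1 * z.2 ^ p.2 : ℝ) : ℂ)) : ℝ) : ℂ) ∂μ := by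
    simp only [← ht, ← integral_complex_ofReal, ← integral_const_mul]
    rw [Finset.sum_congr rfl fun p _ => (integral_finsetSum S fun q _ => h_int' p q).symm,
      ← integral_finsetSum S fun p _ => integrable_finsetSum S fun q _ => h_int' p q]
    refine integral_congr_ae (ae_of_all _ fun z => ?_)
    simp only [Complex.ofReal_mul, Complex.normSq_eq_conj_mul_self, map_sum, map_mul,
      Complex.conj_ofReal]
    rw [mul_comm (∑ p ∈ S, _), Finset.sum_mul_sum, Finset.mul_sum]
    refine Finset.sum_congr rfl fun p _ => ?_
    rw [Finset.mul_sum]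
    refine Finset.sum_congr rfl fun q _ => ?_
    push_cast
    ring
  rw [e, integral_complex_ofReal, Complex.zero_le_real]
  exact integral_nonneg_of_ae (hw.mono fun z hz => mul_nonneg hz (Complex.normSq_nonneg _))

theorem sum_sum_nonneg_of_forall_finsupp {ι : Type*} {f : ι → ι → ℂ}
    (h : ∀ α : ι →₀ ℂ, 0 ≤ ∑ p ∈ α.support, ∑ q ∈ α.support,
      α p * (starRingEnd ℂ) (α q) * f p q) (S : Finset ι) (a : ι → ℂ) :
    0 ≤ ∑ p ∈ S, ∑ q ∈ S, a p * (starRingEnd ℂ) (a q) * f p q := by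
  set α := Finsupp.indicator S fun i _ => a i
  have hα : ∀ p ∈ S, α p = a p := fun p hp => Finsupp.indicator_of_mem hp _
  have hsub : α.support ⊆ S := Finsupp.support_indicator_subset _ _
  have h0 : ∀ p, p ∉ α.support → α p = 0 := fun p => Finsupp.notMem_support_iff.1
  convert h α using 1
  rw [Finset.sum_subset hsub fun p _ hp => by simp [h0 p hp]]
  refine Finset.sum_congr rfl fun p hp => ?_
  rw [Finset.sum_subset hsub fun q _ hq => by simp [h0 q hq]]
  exact Finset.sum_congr rfl fun q hq => by rw [hα p hp, hα q hq]

/-- The linear functional on polynomials in two variables with prescribed values on monomials. -/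
noncomputable def momentFunctional (σ : ℕ → ℕ → ℝ) : MvPolynomial (Fin 2) ℝ →ₗ[ℝ] ℝ :=
  (MvPolynomial.basisMonomials (Fin 2) ℝ).constr ℝ fun d => σ (d 0) (d 1)

theorem momentFunctional_monomial (σ : ℕ → ℕ → ℝ) (d : Fin 2 →₀ ℕ) (c : ℝ) :
    momentFunctional σ (MvPolynomial.monomial d c) = c * σ (d 0) (d 1) := by
  have e : MvPolynomial.monomial d c = c • MvPolynomial.basisMonomials (Fin 2) ℝ d := by
    rw [MvPolynomial.coe_basisMonomials, MvPolynomial.smul_monomial, smul_eq_mul, mul_one]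
  rw [e, map_smul, momentFunctional, Module.Basis.constr_basis, smul_eq_mul]

theorem momentFunctional_mul (σ : ℕ → ℕ → ℝ) (p q : MvPolynomial (Fin 2) ℝ) :
    momentFunctional σ (p * q) = ∑ d ∈ p.support, ∑ e ∈ q.support,
      p.coeff d * q.coeff e * σ (d 0 + e 0) (d 1 + e 1) := by
  conv_lhs => rw [p.as_sum, q.as_sum]
  simp only [Finset.sum_mul_sum, map_sum, MvPolynomial.monomial_mul, momentFunctional_monomial,
    Finsupp.add_apply]

theorem momentFunctional_sq_nonneg {σ : ℕ → ℕ → ℝ}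
    (h : ∀ α : (ℕ × ℕ) →₀ ℂ, 0 ≤ ∑ p ∈ α.support, ∑ q ∈ α.support,
      α p * (starRingEnd ℂ) (α q) * (σ (p.1 + q.1) (p.2 + q.2) : ℂ))
    (p : MvPolynomial (Fin 2) ℝ) : 0 ≤ momentFunctional σ (p ^ 2) := by
  let i : (Fin 2 →₀ ℕ) ↪ ℕ × ℕ := ⟨fun d => (d 0, d 1), fun d e h => by
    ext k; fin_cases k <;> simp_all⟩
  have h' := sum_sum_nonneg_of_forall_finsupp h (p.support.map i)
    fun z => ((p.coeff (Finsupp.equivFunOnFinite.symm ![z.1, z.2]) : ℝ) : ℂ)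
  have hi : ∀ d : Fin 2 →₀ ℕ, Finsupp.equivFunOnFinite.symm ![(i d).1, (i d).2] = d := fun d => by
    ext k; fin_cases k <;> rfl
  simp only [Finset.sum_map, hi, Complex.conj_ofReal] at h'
  rw [sq, momentFunctional_mul, ← Complex.zero_le_real]
  push_cast
  exact h'

theorem momentFunctional_mul_strip (σ : ℕ → ℕ → ℝ) (R : ℝ) (p : MvPolynomial (Fin 2) ℝ) :
    momentFunctional σ (p * (MvPolynomial.C (R ^ 2) - MvPolynomial.X 1 ^ 2)) =
      momentFunctional (fun m n => R ^ 2 * σ m n - σ m (n + 2)) p := by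
  induction p using MvPolynomial.induction_on' with
  | monomial d c =>
    rw [mul_sub, MvPolynomial.X_pow_eq_monomial, mul_comm _ (MvPolynomial.C _),
      MvPolynomial.C_mul_monomial, MvPolynomial.monomial_mul, map_sub]
    simp only [momentFunctional_monomial, Finsupp.add_apply, Finsupp.single_eq_same]
    simp
    ring
  | add p q hp hq => rw [add_mul, map_add, map_add, hp, hq]

theorem im_eq_zero_of_sum_sum_nonneg {s : ℕ → ℕ → ℂ}
    (h : ∀ α : (ℕ × ℕ) →₀ ℂ, 0 ≤ ∑ p ∈ α.support, ∑ q ∈ α.support,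
      α p * (starRingEnd ℂ) (α q) * s (p.1 + q.1) (p.2 + q.2)) (m n : ℕ) : (s m n).im = 0 := by
  have hS : ∀ S : Finset (ℕ × ℕ), (∑ p ∈ S, ∑ q ∈ S, s (p.1 + q.1) (p.2 + q.2)).im = 0 := by
    intro S
    have hnonneg := sum_sum_nonneg_of_forall_finsupp
      (f := fun p q : ℕ × ℕ => s (p.1 + q.1) (p.2 + q.2)) h S (fun _ => 1)
    simp only [map_one, one_mul] at hnonneg
    exact (Complex.nonneg_iff.1 hnonneg).2.symm
  have hdiag : ∀ k l, (s (k + k) (l + l)).im = 0 := fun k l => by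
    simpa only [Finset.sum_singleton] using hS {(k, l)}
  by_cases hmn : (m, n) = (0, 0)
  · obtain ⟨rfl, rfl⟩ := Prod.mk.inj hmn
    exact hdiag 0 0
  have h2 := hS {(m, n), (0, 0)}
  have h0 := hdiag 0 0
  simp only [Finset.sum_pair hmn, Complex.add_im, hdiag, add_zero,
    zero_add] at h2 h0
  linarith

/-- Theorem 2.2: The two-dimensional moment problem in the strip
`Π(R) = {(x₁,x₂) : |x₂| ≤ R}` with prescribed moments `s_{m,n}` has a solution (a
non-negative Borel measure `μ` on `Π(R)` with `∫ x₁ᵐ x₂ⁿ dμ = s_{m,n}`) if and only if for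
every finitely supported complex family `α`:
(i) `∑ α_{m,n} conj(α_{k,l}) s_{m+k,n+l} ≥ 0` and
(ii) `∑ α_{m,n} conj(α_{k,l}) (R² s_{m+k,n+l} − s_{m+k,n+l+2}) ≥ 0`. -/
theorem stmt15 (R : ℝ) (hR : 0 < R) (s : ℕ → ℕ → ℂ) :
    (∃ μ : Measure (ℝ × ℝ),
      (∀ᵐ p ∂μ, |p.2| ≤ R) ∧
      (∀ m n : ℕ, Integrable (fun p : ℝ × ℝ => p.1 ^ m * p.2 ^ n) μ) ∧
      (∀ m n : ℕ, ((∫ p : ℝ × ℝ, p.1 ^ m * p.2 ^ n ∂μ : ℝ) : ℂ) = s m n)) ↔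
    ((∀ α : (ℕ × ℕ) →₀ ℂ,
        0 ≤ ∑ p ∈ α.support, ∑ q ∈ α.support,
          α p * (starRingEnd ℂ) (α q) * s (p.1 + q.1) (p.2 + q.2)) ∧
     (∀ α : (ℕ × ℕ) →₀ ℂ,
        0 ≤ ∑ p ∈ α.support, ∑ q ∈ α.support,
          α p * (starRingEnd ℂ) (α q) *
            ((R : ℂ) ^ 2 * s (p.1 + q.1) (p.2 + q.2) - s (p.1 + q.1) (p.2 + q.2 + 2)))) := by
  constructor
  · rintro ⟨μ, hμ, h_int, hs⟩
    refine ⟨fun α => ?_, fun α => ?_⟩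
    · exact sum_sum_mul_conj_nonneg_of_integral (w := fun _ => 1)
        (ae_of_all _ fun _ => zero_le_one) (by simpa using h_int) (by simpa using hs) _ α
    · have hsplit : ∀ m n : ℕ, (fun z : ℝ × ℝ => (R ^ 2 - z.2 ^ 2) * (z.1 ^ m * z.2 ^ n)) =
          fun z => R ^ 2 * (z.1 ^ m * z.2 ^ n) - z.1 ^ m * z.2 ^ (n + 2) := fun m n => by
        ext z; ring
      refine sum_sum_mul_conj_nonneg_of_integral (w := fun z => R ^ 2 - z.2 ^ 2)
        (t := fun m n => (R : ℂ) ^ 2 * s m n - s m (n + 2))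
        (hμ.mono fun z hz => sub_nonneg.2 (sq_le_sq.2 (by rwa [abs_of_pos hR])))
        (fun m n => ?_) (fun m n => ?_) _ α
      · rw [hsplit]
        exact ((h_int m n).const_mul _).sub (h_int m (n + 2))
      · rw [hsplit, integral_sub ((h_int m n).const_mul _) (h_int m (n + 2)), integral_const_mul]
        push_cast
        rw [hs, hs]
  · rintro ⟨h1, h2⟩
    have hreal : ∀ m n, (((s m n).re : ℝ) : ℂ) = s m n := fun m n =>
      Complex.ext rfl (im_eq_zero_of_sum_sum_nonneg h1 m n).symm
    set σ : ℕ → ℕ → ℝ := fun m n => (s m n).re with hσ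
    let L := momentFunctional σ
    have hL1 : ∀ p, 0 ≤ L (p ^ 2) := momentFunctional_sq_nonneg (by simpa only [hσ, hreal] using h1)
    have hL2 : ∀ p, 0 ≤ L (p ^ 2 * (MvPolynomial.C (R ^ 2) - MvPolynomial.X 1 ^ 2)) := fun p => by
      rw [momentFunctional_mul_strip]
      refine momentFunctional_sq_nonneg ?_ p
      push_cast
      simpa only [hσ, hreal] using h2
    let K := {z : ℝ × ℝ // |z.2| ≤ R}
    have hK_closed : IsClosed {z : ℝ × ℝ | |z.2| ≤ R} :=
      isClosed_le (continuous_abs.comp continuous_snd) continuous_const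
    have hK_emb : Topology.IsClosedEmbedding (Subtype.val : K → ℝ × ℝ) :=
      hK_closed.isClosedEmbedding_subtypeVal
    have : LocallyCompactSpace K := hK_emb.locallyCompactSpace
    let ev : MvPolynomial (Fin 2) ℝ →ₐ[ℝ] C(K, ℝ) := MvPolynomial.aeval
      ![⟨fun k => k.1.1, by fun_prop⟩, ⟨fun k => k.1.2, by fun_prop⟩]
    have hev : ∀ p k, ev p k = MvPolynomial.eval ![k.1.1, k.1.2] p := fun p k => by
      induction p using MvPolynomial.induction_on with
      | C a => simp [ev]
      | add p q hp hq => rw [map_add, map_add, ContinuousMap.add_apply, hp, hq]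
      | mul_X p i hp =>
        rw [map_mul, map_mul, ContinuousMap.mul_apply, hp]
        fin_cases i <;> simp [ev]
    have hh : ∀ k, ev (MvPolynomial.X 0 ^ 2) k = k.1.1 ^ 2 := fun k => by simp [hev]
    obtain ⟨μ, hμ⟩ := exists_measure_of_map_nonneg ev L
      (fun p hp => map_nonneg_of_nonneg_on_strip hR hL1 hL2 p fun x y hy => by
        simpa only [hev] using hp ⟨(x, y), hy⟩)
      (MvPolynomial.X 0 ^ 2) (fun k => by rw [hh]; positivity)
      (fun c => by
        refine hK_emb.isCompact_preimage (K := Set.Icc (-√c) √c ×ˢ Set.Icc (-R) R)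
          (isCompact_Icc.prod isCompact_Icc) |>.of_isClosed_subset
          (isClosed_le (ev _).continuous continuous_const) fun k hk => ?_
        rw [Set.mem_ofPred_eq, hh] at hk
        exact ⟨abs_le.1 (Real.abs_le_sqrt hk), abs_le.1 k.2⟩)
    have hmeas : MeasurableEmbedding (Subtype.val : K → ℝ × ℝ) := hK_emb.measurableEmbedding
    have hmon : ∀ m n : ℕ, ⇑(ev (MvPolynomial.X 0 ^ m * MvPolynomial.X 1 ^ n)) =
        (fun z : ℝ × ℝ => z.1 ^ m * z.2 ^ n) ∘ Subtype.val := fun m n => by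
      ext k; simp [hev]
    have hLmon : ∀ m n : ℕ, L (MvPolynomial.X 0 ^ m * MvPolynomial.X 1 ^ n) = σ m n := fun m n => by
      rw [MvPolynomial.X_pow_eq_monomial, MvPolynomial.X_pow_eq_monomial, MvPolynomial.monomial_mul]
      simp [L, momentFunctional_monomial]
    refine ⟨μ.map Subtype.val, ?_, fun m n => ?_, fun m n => ?_⟩
    · rw [hmeas.ae_map_iff]
      exact ae_of_all _ fun k => k.2
    · rw [hmeas.integrable_map_iff, ← hmon]
      exact (hμ _).1
    · rw [hmeas.integral_map]
      have := (hμ (MvPolynomial.X 0 ^ m * MvPolynomial.X 1 ^ n)).2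
      rw [hmon, hLmon] at this
      rw [← hreal m n]
      exact congrArg _ this
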